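/- arXiv:2503.20106 — 3 statements merged into one kernel-verified Lean document; each statement's English description precedes it below -/
import Mathlib

section
/- A loopless graph G has a graph H as a cc-minor (where, for this statement only, loops created by cycle contractions are not required to be contracted) if and only if G has (i) a collection {G_v : v ∈ V(H)} of pairwise disjoint subgraphs such that each G_v is either a 2-edge-connected subgraph of G or a single-vertex subgraph of G, and the union of the vertex sets of the G_v is V(G); and (ii) a set {f_e : e ∈ E(H)} of distinct edges of G whose complement in E(G) is the union of the edge sets of the G_v, such that for every edge e of H with endpoints u and v, the endpoints of f_e lie in G_u and G_v, respectively. -/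
open scoped Classical

noncomputable section

/-- A finite multigraph with vertices and edge names drawn from `ℕ`.
Each edge name `e ∈ E` has a pair of (possibly equal) endpoints `ends e`. -/
structure MGraph where
  V : Finset ℕ
  E : Finset ℕ
  ends : ℕ → Sym2 ℕ
  ends_mem : ∀ e ∈ E, ∀ v ∈ ends e, v ∈ V

namespace MGraph

/-- Adjacency via some edge. -/
def Adj (G : MGraph) (u v : ℕ) : Prop := ∃ e ∈ G.E, G.ends e = s(u, v)

/-- Reachability. -/
def Reach (G : MGraph) : ℕ → ℕ → Prop := Relation.ReflTransGen G.Adj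

/-- A graph is connected if it has a vertex and all vertices are mutually reachable. -/
def Connected (G : MGraph) : Prop :=
  G.V.Nonempty ∧ ∀ u ∈ G.V, ∀ v ∈ G.V, G.Reach u v

/-- Delete a set of edges. -/
def deleteEdges (G : MGraph) (Z : Finset ℕ) : MGraph where
  V := G.V
  E := G.E \ Z
  ends := G.ends
  ends_mem := fun e he => G.ends_mem e (Finset.mem_sdiff.mp he).1

/-- A graph with at least two vertices is `k`-edge-connected if deleting any
set of fewer than `k` edges leaves it connected. -/
def EdgeConnected (G : MGraph) (k : ℕ) : Prop :=
  2 ≤ G.V.card ∧ ∀ Z ⊆ G.E, Z.card < k → (G.deleteEdges Z).Connected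

/-- A graph is loopless if no edge has equal endpoints. -/
def Loopless (G : MGraph) : Prop := ∀ e ∈ G.E, ¬ (G.ends e).IsDiag

/-- The set of vertices met by an edge set. -/
def vertsOf (G : MGraph) (C : Finset ℕ) : Finset ℕ :=
  G.V.filter (fun v => ∃ e ∈ C, v ∈ G.ends e)

/-- Degree of `v` in the edge set `C` (loops counted twice). -/
def degIn (G : MGraph) (C : Finset ℕ) (v : ℕ) : ℕ :=
  ∑ e ∈ C, (if G.ends e = s(v, v) then 2 else if v ∈ G.ends e then 1 else 0)

/-- `C` is the edge set of a cycle of `G`: a nonempty connected edge set in which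
every vertex met has degree exactly two (a loop and a pair of parallel edges are cycles). -/
def IsCycleSet (G : MGraph) (C : Finset ℕ) : Prop :=
  C.Nonempty ∧ C ⊆ G.E ∧
  (∀ v ∈ G.vertsOf C, G.degIn C v = 2) ∧
  ∀ u ∈ G.vertsOf C, ∀ v ∈ G.vertsOf C,
    Relation.ReflTransGen (fun a b => ∃ e ∈ C, G.ends e = s(a, b)) u v

/-- The vertex map identifying all vertices of `U` (within `G.V`) to a single one. -/
def cmapOn (G : MGraph) (U : Finset ℕ) : ℕ → ℕ :=
  fun v => if v ∈ U ∩ G.V then sInf {w : ℕ | w ∈ U ∩ G.V} else v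

/-- Contract the vertex set `U` to a single vertex, deleting the edges of `S` and all
newly created loops (edges with both ends in `U` that were not already loops), while
keeping pre-existing loops not in `S`. -/
def contractOn (G : MGraph) (U S : Finset ℕ) : MGraph where
  V := G.V.image (G.cmapOn U)
  E := G.E.filter (fun e => ¬ (∀ v ∈ G.ends e, v ∈ U) ∨ ((G.ends e).IsDiag ∧ e ∉ S))
  ends := fun e => (G.ends e).map (G.cmapOn U)
  ends_mem := by
    intro e he v hv
    have he' : e ∈ G.E := (Finset.mem_filter.mp he).1
    rw [Sym2.mem_map] at hv
    obtain ⟨w, hw, rfl⟩ := hv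
    have hwV : w ∈ G.V := G.ends_mem e he' w hw
    by_cases h : w ∈ U ∩ G.V
    · have hmem : sInf {x : ℕ | x ∈ U ∩ G.V} ∈ U ∩ G.V := Nat.sInf_mem ⟨w, h⟩
      refine Finset.mem_image.mpr ⟨sInf {x : ℕ | x ∈ U ∩ G.V},
        (Finset.mem_inter.mp hmem).2, ?_⟩
      simp [cmapOn, h, hmem]
    · exact Finset.mem_image.mpr ⟨w, hwV, by simp [cmapOn, h]⟩

/-- Contract a cycle (given by its edge set), deleting all created loops. -/
def contractCycle (G : MGraph) (C : Finset ℕ) : MGraph :=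
  G.contractOn (G.vertsOf C) C

/-- `H` is a cycle-contraction minor (cc-minor) of `G`: `H` is obtained from `G` by
a sequence of cycle contractions (each accompanied by contraction of created loops). -/
def CCMinor (G H : MGraph) : Prop :=
  Relation.ReflTransGen (fun A B => ∃ C, A.IsCycleSet C ∧ B = A.contractCycle C) G H

/-- Walks: a vertex list together with a matching edge list. -/
inductive IsWalk (G : MGraph) : List ℕ → List ℕ → Prop
  | nil {v : ℕ} (hv : v ∈ G.V) : IsWalk G [v] []
  | cons {u v : ℕ} {e : ℕ} {vs es : List ℕ} (he : e ∈ G.E)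
      (hends : G.ends e = s(u, v)) (hw : IsWalk G (v :: vs) es) :
      IsWalk G (u :: v :: vs) (e :: es)

/-- A path from `u` to `v`, given by its vertex list and edge list. -/
def IsPathBetween (G : MGraph) (u v : ℕ) (vs es : List ℕ) : Prop :=
  G.IsWalk vs es ∧ vs.Nodup ∧ vs.head? = some u ∧ vs.getLast? = some v

/-- `G` is `k`-connected: it has at least `k` vertices and any two distinct vertices are
joined by at least `k` pairwise internally disjoint paths. -/
def KConnected (G : MGraph) (k : ℕ) : Prop :=
  k ≤ G.V.card ∧ ∀ u ∈ G.V, ∀ v ∈ G.V, u ≠ v →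
    ∃ P : Fin k → List ℕ × List ℕ,
      (∀ i, G.IsPathBetween u v (P i).1 (P i).2) ∧
      ∀ i j, i ≠ j →
        (∀ x, x ∈ (P i).1 → x ∈ (P j).1 → x = u ∨ x = v) ∧
        (∀ e, e ∈ (P i).2 → e ∉ (P j).2)

/-- A simple graph: no loops and no parallel edges. -/
def Simple (G : MGraph) : Prop :=
  G.Loopless ∧ ∀ e ∈ G.E, ∀ f ∈ G.E, G.ends e = G.ends f → e = f

/-- Graph isomorphism. -/
def Iso (G H : MGraph) : Prop :=
  ∃ φ ψ : ℕ → ℕ, Set.BijOn φ ↑G.V ↑H.V ∧ Set.BijOn ψ ↑G.E ↑H.E ∧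
    ∀ e ∈ G.E, H.ends (ψ e) = (G.ends e).map φ

/-- The bond graph `B n`: two vertices joined by `n` parallel edges. -/
def IsBondGraph (H : MGraph) (n : ℕ) : Prop :=
  ∃ u v : ℕ, u ≠ v ∧ H.V = {u, v} ∧ H.E.card = n ∧ ∀ e ∈ H.E, H.ends e = s(u, v)

end MGraph

namespace MGraph

/-- `F` is a subgraph of `G`. -/
def IsSubgraph (F G : MGraph) : Prop :=
  F.V ⊆ G.V ∧ F.E ⊆ G.E ∧ ∀ e ∈ F.E, F.ends e = G.ends e

end MGraph

namespace MGraph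

/-- Contract a cycle `C` of `G` without contracting the loops this creates. -/
def contractCycleKeep (G : MGraph) (C : Finset ℕ) : MGraph where
  V := G.V.image (G.cmapOn (G.vertsOf C))
  E := G.E \ C
  ends := fun e => (G.ends e).map (G.cmapOn (G.vertsOf C))
  ends_mem := by
    intro e he v hv
    have he' : e ∈ G.E := (Finset.mem_sdiff.mp he).1
    rw [Sym2.mem_map] at hv
    obtain ⟨w, hw, rfl⟩ := hv
    have hwV : w ∈ G.V := G.ends_mem e he' w hw
    by_cases h : w ∈ G.vertsOf C ∩ G.V
    · have hmem : sInf {x : ℕ | x ∈ G.vertsOf C ∩ G.V} ∈ G.vertsOf C ∩ G.V :=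
        Nat.sInf_mem ⟨w, h⟩
      refine Finset.mem_image.mpr ⟨sInf {x : ℕ | x ∈ G.vertsOf C ∩ G.V},
        (Finset.mem_inter.mp hmem).2, ?_⟩
      simp [cmapOn, h, hmem]
    · exact Finset.mem_image.mpr ⟨w, hwV, by simp [cmapOn, h]⟩

/-- The cc-minor relation in which loops created by cycle contractions are kept. -/
def CCMinorKeep (G H : MGraph) : Prop :=
  Relation.ReflTransGen (fun A B => ∃ C, A.IsCycleSet C ∧ B = A.contractCycleKeep C) G H

end MGraph

namespace MGraph

/-- Reachability along the edges in `S`, for the incidence function `ends`. -/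
def ReachIn (ends : ℕ → Sym2 ℕ) (S : Finset ℕ) : ℕ → ℕ → Prop :=
  Relation.ReflTransGen (fun a b => ∃ e ∈ S, ends e = s(a, b))

section ReachIn

variable {ends : ℕ → Sym2 ℕ} {S T : Finset ℕ} {u v w : ℕ}

theorem ReachIn.mono (hST : S ⊆ T) (h : ReachIn ends S u v) : ReachIn ends T u v :=
  Relation.ReflTransGen.mono (fun _ _ ⟨e, he, h'⟩ => ⟨e, hST he, h'⟩) _ _ h

theorem ReachIn.symm (h : ReachIn ends S u v) : ReachIn ends S v u := by
  induction h with
  | refl => exact .refl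
  | tail _ h2 ih =>
    obtain ⟨e, he, h'⟩ := h2
    exact .head ⟨e, he, h'.trans Sym2.eq_swap⟩ ih

theorem ReachIn.trans (h : ReachIn ends S u v) (h' : ReachIn ends S v w) : ReachIn ends S u w :=
  Relation.ReflTransGen.trans h h'

theorem ReachIn.of_edge {e : ℕ} (he : e ∈ S) (h : ends e = s(u, v)) : ReachIn ends S u v :=
  .single ⟨e, he, h⟩

/-- A property shared by the two ends of each edge is preserved by reachability. -/
theorem ReachIn.preserves {p : ℕ → Prop} (hp : ∀ e ∈ S, ∀ a b, ends e = s(a, b) → p a → p b)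
    (h : ReachIn ends S u v) (hu : p u) : p v := by
  induction h with
  | refl => exact hu
  | tail _ h2 ih =>
    obtain ⟨e, he, h'⟩ := h2
    exact hp e he _ _ h' ih

/-- Reachability lifts along a vertex map whose fibres are connected. -/
theorem ReachIn.lift {π : ℕ → ℕ} {V : Finset ℕ}
    (hfib : ∀ u ∈ V, ∀ v ∈ V, π u = π v → ReachIn ends T u v) (hST : S ⊆ T)
    (hV : ∀ e ∈ S, ∀ x ∈ ends e, x ∈ V) {a b : ℕ}
    (h : ReachIn (fun e => (ends e).map π) S a b) :
    ∀ u ∈ V, ∀ v ∈ V, π u = a → π v = b → ReachIn ends T u v := by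
  induction h with
  | refl => exact fun u hu v hv h1 h2 => hfib u hu v hv (h1.trans h2.symm)
  | @tail b c _ h2 ih =>
    intro u hu v hv hua hvc
    obtain ⟨e, he, h'⟩ := h2
    obtain ⟨x, y, hxy⟩ : ∃ x y, ends e = s(x, y) := by
      induction ends e with | _ x y => exact ⟨x, y, rfl⟩
    have hx : x ∈ V := hV e he x (by simp [hxy])
    have hy : y ∈ V := hV e he y (by simp [hxy])
    simp only [hxy, Sym2.map_mk, Sym2.eq_iff] at h'
    rcases h' with ⟨h1, h2⟩ | ⟨h1, h2⟩
    · exact ((ih u hu x hx hua h1).trans (.of_edge (hST he) hxy)).trans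
        (hfib y hy v hv (h2.trans hvc.symm))
    · exact ((ih u hu y hy hua h2).trans (ReachIn.of_edge (hST he) hxy).symm).trans
        (hfib x hx v hv (h1.trans hvc.symm))

/-- Reachability projects along a vertex map collapsing the edges outside `S`. -/
theorem ReachIn.project {π : ℕ → ℕ}
    (hT : ∀ e ∈ T, e ∈ S ∨ ∀ x y, ends e = s(x, y) → π x = π y)
    (h : ReachIn ends T u v) : ReachIn (fun e => (ends e).map π) S (π u) (π v) := by
  induction h with
  | refl => exact .refl
  | tail _ h2 ih =>
    obtain ⟨e, he, h'⟩ := h2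
    rcases hT e he with h3 | h3
    · exact ih.trans (.of_edge h3 (by simp [h']))
    · rw [← h3 _ _ h']; exact ih

/-- A walk leaving `u` may be rerouted so as never to return to `u`. -/
theorem ReachIn.exists_first_edge (h : ReachIn ends S u v) (huv : v ≠ u) :
    ∃ e ∈ S, ∃ w, w ≠ u ∧ ends e = s(u, w) ∧
      ReachIn ends (S.filter fun e => u ∉ ends e) w v := by
  induction h with
  | refl => exact absurd rfl huv
  | @tail b c _ h2 ih =>
    obtain ⟨e, he, h'⟩ := h2
    by_cases hb : b = u
    · subst hb
      exact ⟨e, he, c, huv, h', .refl⟩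
    · obtain ⟨f, hf, w, hw, hfw, hr⟩ := ih hb
      refine ⟨f, hf, w, hw, hfw, hr.trans (.of_edge (e := e) ?_ h')⟩
      simp [he, h', Ne.symm hb, Ne.symm huv]

end ReachIn

theorem edge_contribution {s : Sym2 ℕ} {x y : ℕ} (h : s = s(x, y)) (v : ℕ) :
    (if s = s(v, v) then 2 else if v ∈ s then 1 else 0) =
      (if v = x then 1 else 0) + (if v = y then 1 else 0) := by
  subst h
  by_cases h1 : v = x <;> by_cases h2 : v = y <;>
    simp [h1, h2, eq_comm] <;> grind

theorem degIn_insert (G : MGraph) {C : Finset ℕ} {e x y : ℕ} (he : e ∉ C)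
    (h : G.ends e = s(x, y)) (v : ℕ) :
    G.degIn (insert e C) v =
      (if v = x then 1 else 0) + (if v = y then 1 else 0) + G.degIn C v := by
  rw [degIn, Finset.sum_insert he, edge_contribution h, degIn]

theorem degIn_eq_zero (G : MGraph) {C : Finset ℕ} {v : ℕ} (h : ∀ e ∈ C, v ∉ G.ends e) :
    G.degIn C v = 0 := by
  refine Finset.sum_eq_zero fun e he => ?_
  have := h e he
  rw [if_neg, if_neg this]
  intro h'
  simp [h'] at this

theorem degIn_pos (G : MGraph) {C : Finset ℕ} {e v : ℕ} (he : e ∈ C) (h : v ∈ G.ends e) :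
    0 < G.degIn C v := by
  refine lt_of_lt_of_le ?_ (Finset.single_le_sum (fun _ _ => Nat.zero_le _) he)
  simp only [h, if_true]
  split_ifs <;> simp

/-- Reachability is witnessed by the edge set of a path. -/
theorem exists_path_edges (G : MGraph) (n : ℕ) : ∀ (P : Finset ℕ) (x y : ℕ), P.card ≤ n →
    ReachIn G.ends P x y → ∃ Q ⊆ P,
      (∀ v, G.degIn Q v + (if v = x then 1 else 0) + (if v = y then 1 else 0) = 0 ∨
        G.degIn Q v + (if v = x then 1 else 0) + (if v = y then 1 else 0) = 2) ∧
      ∀ e ∈ Q, ∀ v ∈ G.ends e, ReachIn G.ends Q x v := by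
  induction n with
  | zero =>
    intro P x y hP h
    obtain rfl : P = ∅ := by simpa using hP
    obtain rfl : y = x := by
      by_contra hne
      obtain ⟨e, he, -⟩ := h.exists_first_edge hne
      simp at he
    refine ⟨∅, by simp, fun v => ?_, by simp⟩
    by_cases hv : v = y <;> simp [degIn, hv]
  | succ n ih =>
    intro P x y hP h
    by_cases hne : y = x
    · subst hne
      refine ⟨∅, by simp, fun v => ?_, by simp⟩
      by_cases hv : v = y <;> simp [degIn, hv]
    obtain ⟨e, he, w, hw, hew, hr⟩ := h.exists_first_edge hne
    have hlt : (P.filter fun e => x ∉ G.ends e).card < P.card := by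
      refine Finset.card_lt_card (Finset.filter_ssubset.2 ⟨e, he, by simp [hew]⟩)
    obtain ⟨Q, hQ, hdeg, hreach⟩ := ih _ w y (by omega) hr
    have hx : ∀ f ∈ Q, x ∉ G.ends f := fun f hf => (Finset.mem_filter.1 (hQ hf)).2
    have heQ : e ∉ Q := fun h => hx e h (by simp [hew])
    refine ⟨insert e Q, ?_, fun v => ?_, ?_⟩
    · exact Finset.insert_subset he (hQ.trans (Finset.filter_subset _ _))
    · rw [degIn_insert G heQ hew]
      by_cases hv : v = x
      · subst hv
        simp [degIn_eq_zero G hx, Ne.symm hw, Ne.symm hne]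
      · have := hdeg v
        simp only [hv, if_false]
        omega
    · have hxw : ReachIn G.ends (insert e Q) x w := .of_edge (Finset.mem_insert_self _ _) hew
      intro f hf v hv
      rcases Finset.mem_insert.1 hf with rfl | hf
      · rw [hew, Sym2.mem_iff] at hv
        rcases hv with rfl | rfl
        · exact .refl
        · exact hxw
      · exact hxw.trans ((hreach f hf v hv).mono (Finset.subset_insert _ _))

/-- An edge that is not a bridge of `F` lies on a cycle contained in `F`. -/
theorem exists_cycle (G : MGraph) {F : Finset ℕ} (hF : F ⊆ G.E) {e x y : ℕ} (he : e ∈ F)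
    (hxy : G.ends e = s(x, y)) (h : ReachIn G.ends (F.erase e) x y) :
    ∃ C ⊆ F, e ∈ C ∧ G.IsCycleSet C := by
  obtain ⟨Q, hQ, hdeg, hreach⟩ := exists_path_edges G _ _ x y le_rfl h
  have heQ : e ∉ Q := fun h => by simpa using hQ h
  have hsub : insert e Q ⊆ F :=
    Finset.insert_subset he (hQ.trans (Finset.erase_subset _ _))
  have key : ∀ v ∈ G.vertsOf (insert e Q), ReachIn G.ends (insert e Q) x v := by
    intro v hv
    obtain ⟨-, f, hf, hvf⟩ := Finset.mem_filter.1 hv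
    rcases Finset.mem_insert.1 hf with rfl | hf
    · rw [hxy, Sym2.mem_iff] at hvf
      rcases hvf with rfl | rfl
      · exact .refl
      · exact .of_edge (Finset.mem_insert_self _ _) hxy
    · exact (hreach f hf v hvf).mono (Finset.subset_insert _ _)
  refine ⟨insert e Q, hsub, Finset.mem_insert_self _ _, ⟨e, Finset.mem_insert_self _ _⟩,
    hsub.trans hF, fun v hv => ?_, fun u hu v hv => (key u hu).symm.trans (key v hv)⟩
  obtain ⟨-, f, hf, hvf⟩ := Finset.mem_filter.1 hv
  have h1 := degIn_pos G hf hvf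
  rw [degIn_insert G heQ hxy] at h1 ⊢
  have := hdeg v
  omega

theorem mem_vertsOf (G : MGraph) {C : Finset ℕ} (hC : C ⊆ G.E) {e v : ℕ} (he : e ∈ C)
    (hv : v ∈ G.ends e) : v ∈ G.vertsOf C :=
  Finset.mem_filter.2 ⟨G.ends_mem e (hC he) v hv, e, he, hv⟩

/-- A cycle has no bridge. -/
theorem IsCycleSet.reachIn_erase_ends {G : MGraph} {C : Finset ℕ} (hC : G.IsCycleSet C)
    {z p q : ℕ} (hz : z ∈ C) (hpq : G.ends z = s(p, q)) :
    ReachIn G.ends (C.erase z) p q := by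
  by_contra hcon
  set S := (G.vertsOf C).filter fun v => ReachIn G.ends (C.erase z) p v with hS
  have hpS : p ∈ S := Finset.mem_filter.2 ⟨mem_vertsOf G hC.2.1 hz (by simp [hpq]), .refl⟩
  have hqS : q ∉ S := fun h => hcon (Finset.mem_filter.1 h).2
  have hsum : ∑ v ∈ S, G.degIn C v = ∑ v ∈ S, 2 :=
    Finset.sum_congr rfl fun v hv => hC.2.2.1 v (Finset.mem_filter.1 hv).1
  have hcontr : ∀ e x y, G.ends e = s(x, y) →
      ∑ v ∈ S, (if G.ends e = s(v, v) then 2 else if v ∈ G.ends e then 1 else 0) =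
        (if x ∈ S then 1 else 0) + (if y ∈ S then 1 else 0) := by
    intro e x y hxy
    simp only [edge_contribution hxy, Finset.sum_add_distrib, Finset.sum_ite_eq']
  have heven : Even (∑ e ∈ C.erase z,
      ∑ v ∈ S, (if G.ends e = s(v, v) then 2 else if v ∈ G.ends e then 1 else 0)) := by
    refine Finset.even_sum _ fun e he => ?_
    obtain ⟨x, y, hxy⟩ : ∃ x y, G.ends e = s(x, y) := by
      induction G.ends e with | _ x y => exact ⟨x, y, rfl⟩
    have heC := Finset.mem_of_mem_erase he
    have hx := mem_vertsOf G hC.2.1 heC (v := x) (by simp [hxy])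
    have hy := mem_vertsOf G hC.2.1 heC (v := y) (by simp [hxy])
    have hr : ReachIn G.ends (C.erase z) x y := .of_edge he hxy
    have hiff : x ∈ S ↔ y ∈ S := by
      simp only [hS, Finset.mem_filter, hx, hy, true_and]
      exact ⟨fun h => h.trans hr, fun h => h.trans hr.symm⟩
    rw [hcontr e x y hxy]
    by_cases h : x ∈ S
    · simp [h, hiff.1 h]
    · simp [h, hiff.not.1 h]
  simp only [degIn] at hsum
  rw [Finset.sum_comm, ← Finset.add_sum_erase C _ hz, hcontr z p q hpq] at hsum
  simp only [hpS, hqS, if_true, if_false, Finset.sum_const, smul_eq_mul] at hsum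
  obtain ⟨k, hk⟩ := heven
  omega

/-- Deleting an edge from a cycle leaves its vertices mutually reachable. -/
theorem IsCycleSet.reachIn_erase {G : MGraph} {C : Finset ℕ} (hC : G.IsCycleSet C) (z : ℕ)
    {u v : ℕ} (hu : u ∈ G.vertsOf C) (hv : v ∈ G.vertsOf C) :
    ReachIn G.ends (C.erase z) u v := by
  refine ReachIn.preserves (p := ReachIn G.ends (C.erase z) u) ?_ (hC.2.2.2 u hu v hv) .refl
  intro e he a b hab h
  by_cases hez : e = z
  · subst hez
    exact h.trans (hC.reachIn_erase_ends he hab)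
  · exact h.trans (.of_edge (Finset.mem_erase.2 ⟨hez, he⟩) hab)

theorem cmapOn_eq_iff (G : MGraph) {C : Finset ℕ} {u v : ℕ} :
    G.cmapOn (G.vertsOf C) u = G.cmapOn (G.vertsOf C) v ↔
      u = v ∨ (u ∈ G.vertsOf C ∧ v ∈ G.vertsOf C) := by
  have hUV : G.vertsOf C ∩ G.V = G.vertsOf C :=
    Finset.inter_eq_left.2 (Finset.filter_subset _ _)
  have hmin : ∀ u ∈ G.vertsOf C, sInf {w : ℕ | w ∈ G.vertsOf C} ∈ G.vertsOf C :=
    fun u hu => Nat.sInf_mem (s := {w : ℕ | w ∈ G.vertsOf C}) ⟨u, hu⟩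
  simp only [cmapOn, hUV]
  by_cases hu : u ∈ G.vertsOf C <;> by_cases hv : v ∈ G.vertsOf C <;> simp only [hu, hv, if_true,
    if_false, and_true, and_false, or_false, or_true]
  · exact ⟨fun h => absurd (h ▸ hmin u hu) hv, fun h => absurd (h ▸ hu) hv⟩
  · exact ⟨fun h => absurd (h ▸ hmin v hv) hu, fun h => absurd (h ▸ hv) hu⟩

/-- `K` arises from `G` by collapsing the fibres of `π`, where the removed edges join vertices of
the same fibre and connect each fibre even after the removal of any one edge. -/
structure IsCollapse (G K : MGraph) (π : ℕ → ℕ) : Prop where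
  verts : K.V = G.V.image π
  edges : K.E ⊆ G.E
  ends : K.ends = fun e => (G.ends e).map π
  map_eq : ∀ e ∈ G.E \ K.E, ∀ a b, G.ends e = s(a, b) → π a = π b
  reach : ∀ z, ∀ u ∈ G.V, ∀ v ∈ G.V, π u = π v → ReachIn G.ends ((G.E \ K.E).erase z) u v

theorem CCMinorKeep.exists_isCollapse {G K : MGraph} (h : G.CCMinorKeep K) :
    ∃ π, IsCollapse G K π := by
  induction h with
  | refl =>
    refine ⟨id, by simp, subset_rfl, by simp, by simp, ?_⟩
    rintro z u - v - rfl
    exact .refl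
  | @tail K L _ hstep ih =>
    obtain ⟨π, hπ⟩ := ih
    obtain ⟨C, hC, rfl⟩ := hstep
    have hsub : G.E \ K.E ⊆ G.E \ (K.E \ C) :=
      Finset.sdiff_subset_sdiff subset_rfl Finset.sdiff_subset
    have hCsub : C ⊆ G.E \ (K.E \ C) := fun e he =>
      Finset.mem_sdiff.2 ⟨hπ.edges (hC.2.1 he), fun h => (Finset.mem_sdiff.1 h).2 he⟩
    refine ⟨K.cmapOn (K.vertsOf C) ∘ π, ?_, ?_, ?_, ?_, ?_⟩
    · simp only [contractCycleKeep, hπ.verts, Finset.image_image]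
    · exact Finset.sdiff_subset.trans hπ.edges
    · simp only [contractCycleKeep, hπ.ends, Sym2.map_map]
    · intro e he a b hab
      obtain ⟨heG, heK⟩ := Finset.mem_sdiff.1 he
      simp only [Function.comp]
      by_cases h : e ∈ K.E
      · have heC : e ∈ C := by
          by_contra h'
          exact heK (Finset.mem_sdiff.2 ⟨h, h'⟩)
        rw [cmapOn_eq_iff]
        right
        constructor <;> exact mem_vertsOf K hC.2.1 heC (by simp [hπ.ends, hab])
      · rw [hπ.map_eq e (Finset.mem_sdiff.2 ⟨heG, h⟩) a b hab]
    · intro z u hu v hv huv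
      have hfib : ∀ u ∈ G.V, ∀ v ∈ G.V, π u = π v →
          ReachIn G.ends ((G.E \ (K.E \ C)).erase z) u v := fun u hu v hv h =>
        (hπ.reach z u hu v hv h).mono (Finset.erase_subset_erase _ hsub)
      rcases (cmapOn_eq_iff K).1 huv with h | ⟨h1, h2⟩
      · exact hfib u hu v hv h
      · have hr := hC.reachIn_erase z h1 h2
        rw [hπ.ends] at hr
        refine hr.lift hfib (Finset.erase_subset_erase _ hCsub) ?_ u hu v hv rfl rfl
        intro e he x hx
        exact G.ends_mem e (hπ.edges (hC.2.1 (Finset.mem_of_mem_erase he))) x hx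

/-- A bridgeless edge set can be contracted by cycle contractions. -/
theorem exists_ccMinorKeep_of_bridgeless (n : ℕ) : ∀ (G : MGraph) (F : Finset ℕ), F.card ≤ n →
    F ⊆ G.E → (∀ e ∈ F, ∀ x y, G.ends e = s(x, y) → ReachIn G.ends (F.erase e) x y) →
    ∃ (K : MGraph) (π : ℕ → ℕ), G.CCMinorKeep K ∧ K.V = G.V.image π ∧ K.E = G.E \ F ∧
      K.ends = (fun e => (G.ends e).map π) ∧
      ∀ u ∈ G.V, ∀ v ∈ G.V, (π u = π v ↔ ReachIn G.ends F u v) := by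
  have base : ∀ G : MGraph, ∃ (K : MGraph) (π : ℕ → ℕ), G.CCMinorKeep K ∧ K.V = G.V.image π ∧
      K.E = G.E \ ∅ ∧ K.ends = (fun e => (G.ends e).map π) ∧
      ∀ u ∈ G.V, ∀ v ∈ G.V, (π u = π v ↔ ReachIn G.ends ∅ u v) := by
    intro G
    refine ⟨G, id, .refl, by simp, by simp, by simp, fun u _ v _ => ⟨?_, fun h => ?_⟩⟩
    · rintro rfl
      exact .refl
    · exact h.preserves (p := fun w => id u = id w) (by simp) rfl
  induction n with
  | zero =>
    intro G F hF _ _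
    obtain rfl : F = ∅ := by simpa using hF
    exact base G
  | succ n ih =>
    intro G F hF hFE hb
    rcases F.eq_empty_or_nonempty with rfl | ⟨e, he⟩
    · exact base G
    obtain ⟨x, y, hxy⟩ : ∃ x y, G.ends e = s(x, y) := by
      induction G.ends e with | _ x y => exact ⟨x, y, rfl⟩
    obtain ⟨C, hCF, heC, hC⟩ := exists_cycle G hFE he hxy (hb e he x y hxy)
    set c := G.cmapOn (G.vertsOf C) with hc
    have hcC : ∀ f ∈ C, ∀ x y, G.ends f = s(x, y) → c x = c y := fun f hf x y h =>
      (cmapOn_eq_iff G).2 <| .inr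
        ⟨mem_vertsOf G hC.2.1 hf (by simp [h]), mem_vertsOf G hC.2.1 hf (by simp [h])⟩
    have hcard : (F \ C).card < F.card :=
      Finset.card_lt_card (Finset.ssubset_iff_of_subset Finset.sdiff_subset |>.2
        ⟨e, he, fun h => (Finset.mem_sdiff.1 h).2 heC⟩)
    obtain ⟨K, π, hK, hV, hE, hends, hπ⟩ := ih (G.contractCycleKeep C) (F \ C) (by omega)
      (Finset.sdiff_subset_sdiff hFE subset_rfl) (by
        intro f hf a b hab
        obtain ⟨hfF, hfC⟩ := Finset.mem_sdiff.1 hf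
        obtain ⟨p, q, hpq⟩ : ∃ p q, G.ends f = s(p, q) := by
          induction G.ends f with | _ p q => exact ⟨p, q, rfl⟩
        have hr : ReachIn (G.contractCycleKeep C).ends ((F \ C).erase f) (c p) (c q) := by
          refine ReachIn.project (fun g hg => ?_) (hb f hfF p q hpq)
          obtain ⟨hgf, hgF⟩ := Finset.mem_erase.1 hg
          by_cases hgC : g ∈ C
          · exact .inr (hcC g hgC)
          · exact .inl (Finset.mem_erase.2 ⟨hgf, Finset.mem_sdiff.2 ⟨hgF, hgC⟩⟩)
        simp only [contractCycleKeep, hpq, Sym2.map_mk, Sym2.eq_iff] at hab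
        rcases hab with ⟨rfl, rfl⟩ | ⟨rfl, rfl⟩
        · exact hr
        · exact hr.symm)
    refine ⟨K, π ∘ c, .head ⟨C, hC, rfl⟩ hK, ?_, ?_, ?_, fun u hu v hv => ?_⟩
    · rw [hV, ← Finset.image_image]
      rfl
    · rw [hE]
      ext f
      have := @hCF f
      simp only [contractCycleKeep, Finset.mem_sdiff]
      tauto
    · rw [hends]
      simp only [contractCycleKeep, Sym2.map_map]
      rfl
    · rw [Function.comp, Function.comp, hπ (c u) (Finset.mem_image_of_mem _ hu) (c v)
        (Finset.mem_image_of_mem _ hv)]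
      constructor
      · intro h
        refine ReachIn.lift (π := c) (V := G.V) ?_ Finset.sdiff_subset ?_ h u hu v hv rfl rfl
        · intro a _ b _ hab
          rcases (cmapOn_eq_iff G).1 hab with rfl | ⟨h1, h2⟩
          · exact .refl
          · exact ReachIn.mono hCF (hC.2.2.2 a h1 b h2)
        · exact fun f hf => G.ends_mem f (hFE (Finset.mem_sdiff.1 hf).1)
      · refine ReachIn.project fun g hg => ?_
        by_cases hgC : g ∈ C
        · exact .inr (hcC g hgC)
        · exact .inl (Finset.mem_sdiff.2 ⟨hg, hgC⟩)

/-- The subgraph of `G` with the edges in `F` induced on the fibre of `ρ` over `v`. -/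
def fibre (G : MGraph) (F : Finset ℕ) (ρ : ℕ → ℕ) (v : ℕ) : MGraph where
  V := G.V.filter fun x => ρ x = v
  E := (G.E ∩ F).filter fun e => ∀ x ∈ G.ends e, ρ x = v
  ends := G.ends
  ends_mem := fun e he x hx => by
    simp only [Finset.mem_filter, Finset.mem_inter] at he ⊢
    exact ⟨G.ends_mem e he.1.1 x hx, he.2 x hx⟩

theorem fibre_isSubgraph (G : MGraph) (F : Finset ℕ) (ρ : ℕ → ℕ) (v : ℕ) :
    (G.fibre F ρ v).IsSubgraph G :=
  ⟨Finset.filter_subset _ _, (Finset.filter_subset _ _).trans Finset.inter_subset_left,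
    fun _ _ => rfl⟩

theorem fibre_edgeConnected {G : MGraph} {F : Finset ℕ} {ρ : ℕ → ℕ} {v : ℕ} (hF : F ⊆ G.E)
    (hmap : ∀ e ∈ F, ∀ a b, G.ends e = s(a, b) → ρ a = ρ b)
    (hreach : ∀ z, ∀ x ∈ G.V, ∀ y ∈ G.V, ρ x = ρ y → ReachIn G.ends (F.erase z) x y)
    (hne : ∃ x ∈ G.V, ρ x = v) :
    (G.fibre F ρ v).EdgeConnected 2 ∨ (G.fibre F ρ v).V.card = 1 := by
  obtain ⟨x₀, hx₀, hρ₀⟩ := hne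
  have hx₀' : x₀ ∈ (G.fibre F ρ v).V := Finset.mem_filter.2 ⟨hx₀, hρ₀⟩
  have hpos := Finset.card_pos.2 ⟨x₀, hx₀'⟩
  by_cases h1 : (G.fibre F ρ v).V.card = 1
  · exact .inr h1
  refine .inl ⟨by omega, fun Z _ hZ => ⟨⟨x₀, hx₀'⟩, fun x hx y hy => ?_⟩⟩
  obtain ⟨z, hz⟩ : ∃ z, Z ⊆ {z} := by
    have : Z.card ≤ 1 := by omega
    exact Finset.card_le_one_iff_subset_singleton.1 this
  obtain ⟨hxG, hxv⟩ := Finset.mem_filter.1 hx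
  obtain ⟨hyG, hyv⟩ := Finset.mem_filter.1 hy
  have hr := hreach z x hxG y hyG (hxv.trans hyv.symm)
  refine (ReachIn.preserves (p := fun w => ρ w = v ∧ ((G.fibre F ρ v).deleteEdges Z).Reach x w)
    ?_ hr ⟨hxv, .refl⟩).2
  rintro e he a b hab ⟨ha, hra⟩
  obtain ⟨hez, heF⟩ := Finset.mem_erase.1 he
  have hb : ρ b = v := (hmap e heF a b hab).symm.trans ha
  refine ⟨hb, hra.tail ⟨e, Finset.mem_sdiff.2 ⟨?_, fun h => hez (by simpa using hz h)⟩, hab⟩⟩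
  refine Finset.mem_filter.2 ⟨Finset.mem_inter.2 ⟨hF heF, heF⟩, fun w hw => ?_⟩
  rw [hab, Sym2.mem_iff] at hw
  rcases hw with rfl | rfl
  exacts [ha, hb]

/-- Reachability inside a subgraph which is 2-edge-connected or a single vertex survives the
deletion of one edge. -/
theorem IsSubgraph.reachIn_erase {A G : MGraph} (hA : A.IsSubgraph G)
    (h : A.EdgeConnected 2 ∨ A.V.card = 1) {F : Finset ℕ} (hF : A.E ⊆ F) (z : ℕ) {x y : ℕ}
    (hx : x ∈ A.V) (hy : y ∈ A.V) : ReachIn G.ends (F.erase z) x y := by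
  rcases h with h | h
  · have hr := (h.2 (A.E ∩ {z}) Finset.inter_subset_left
      (lt_of_le_of_lt (Finset.card_le_card Finset.inter_subset_right) (by simp))).2 x hx y hy
    refine Relation.ReflTransGen.mono ?_ _ _ hr
    rintro a b ⟨e, he, hab⟩
    obtain ⟨heA, hez⟩ := Finset.mem_sdiff.1 he
    refine ⟨e, Finset.mem_erase.2 ⟨fun h => hez ?_, hF heA⟩, (hA.2.2 e heA).symm.trans hab⟩
    exact Finset.mem_inter.2 ⟨heA, by simp [h]⟩
  · obtain rfl := Finset.card_le_one.1 h.le x hx y hy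
    exact .refl

end MGraph

/-- A loopless graph `G` has `H` as a cc-minor (loops created by contractions being kept)
if and only if `G` has a collection of disjoint subgraphs `g v` (`v ∈ V(H)`), each
2-edge-connected or a single vertex, covering `V(G)`, together with distinct edges
`f e` (`e ∈ E(H)`) forming the complement of the union of the subgraphs' edge sets, with
the endpoints of `f e` lying in the subgraphs indexed by the endpoints of `e`. -/
theorem statement_2 (G H : MGraph) (hG : G.Loopless) :
    (∃ K, G.CCMinorKeep K ∧ K.Iso H) ↔
      ∃ (g : ℕ → MGraph) (f : ℕ → ℕ),
        (∀ v ∈ H.V, (g v).IsSubgraph G ∧ ((g v).EdgeConnected 2 ∨ (g v).V.card = 1)) ∧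
        (∀ u ∈ H.V, ∀ v ∈ H.V, u ≠ v → ∀ x ∈ (g u).V, x ∉ (g v).V) ∧
        (H.V.biUnion (fun v => (g v).V) = G.V) ∧
        Set.InjOn f ↑H.E ∧ (∀ e ∈ H.E, f e ∈ G.E) ∧
        (G.E \ H.E.image f = H.V.biUnion (fun v => (g v).E)) ∧
        (∀ e ∈ H.E, ∀ u v : ℕ, H.ends e = s(u, v) →
          ∃ a b : ℕ, G.ends (f e) = s(a, b) ∧ a ∈ (g u).V ∧ b ∈ (g v).V) := by
  constructor
  · rintro ⟨K, hGK, φ, ψ, hφ, hψ, hends⟩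
    obtain ⟨π, hπ⟩ := hGK.exists_isCollapse
    have hmap : ∀ e ∈ G.E \ K.E, ∀ a b, G.ends e = s(a, b) → φ (π a) = φ (π b) :=
      fun e he a b hab => congrArg φ (hπ.map_eq e he a b hab)
    have hπV : ∀ x ∈ G.V, π x ∈ K.V := fun x hx => by
      rw [hπ.verts]; exact Finset.mem_image_of_mem _ hx
    have hφV : ∀ x ∈ G.V, φ (π x) ∈ H.V := fun x hx => hφ.mapsTo (hπV x hx)
    have hinv := hψ.invOn_invFunOn
    set f := Function.invFunOn ψ (K.E : Set ℕ) with hf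
    have hfK : ∀ e ∈ H.E, f e ∈ K.E := fun e he => hψ.surjOn.mapsTo_invFunOn he
    have himg : H.E.image f = K.E := by
      ext e
      constructor
      · intro h
        obtain ⟨d, hd, rfl⟩ := Finset.mem_image.1 h
        exact hfK d hd
      · exact fun h => Finset.mem_image.2 ⟨ψ e, hψ.mapsTo h, hinv.1 h⟩
    refine ⟨G.fibre (G.E \ K.E) (φ ∘ π), f, fun v hv => ⟨G.fibre_isSubgraph _ _ _, ?_⟩, ?_, ?_,
      hinv.2.injOn, fun e he => hπ.edges (hfK e he), ?_, ?_⟩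
    · refine MGraph.fibre_edgeConnected Finset.sdiff_subset hmap ?_ ?_
      · exact fun z x hx y hy h => hπ.reach z x hx y hy (hφ.injOn (hπV x hx) (hπV y hy) h)
      · obtain ⟨k, hk, rfl⟩ := hφ.surjOn hv
        rw [hπ.verts] at hk
        obtain ⟨x, hx, rfl⟩ := Finset.mem_image.1 hk
        exact ⟨x, hx, rfl⟩
    · intro u _ v _ huv x hxu hxv
      exact huv ((Finset.mem_filter.1 hxu).2.symm.trans (Finset.mem_filter.1 hxv).2)
    · ext x
      simp only [Finset.mem_biUnion, MGraph.fibre, Finset.mem_filter]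
      exact ⟨fun ⟨_, _, h, _⟩ => h, fun h => ⟨_, hφV x h, h, rfl⟩⟩
    · rw [himg]
      ext e
      simp only [Finset.mem_biUnion, MGraph.fibre, Finset.mem_filter, Finset.mem_inter]
      refine ⟨fun h => ?_, fun ⟨_, _, h, _⟩ => h.2⟩
      have heG := (Finset.mem_sdiff.1 h).1
      obtain ⟨x, y, hxy⟩ : ∃ x y, G.ends e = s(x, y) := by
        induction G.ends e with | _ x y => exact ⟨x, y, rfl⟩
      refine ⟨φ (π x), hφV x (G.ends_mem e heG x (by simp [hxy])), ⟨heG, h⟩, fun w hw => ?_⟩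
      rw [hxy, Sym2.mem_iff] at hw
      rcases hw with rfl | rfl
      · rfl
      · exact (hmap e h x w hxy).symm
    · intro e he u v huv
      have hfe := hfK e he
      have hfG := hπ.edges hfe
      have h1 := hends (f e) hfe
      have h2 : ψ (f e) = e := hinv.2 he
      obtain ⟨x, y, hxy⟩ : ∃ x y, G.ends (f e) = s(x, y) := by
        induction G.ends (f e) with | _ x y => exact ⟨x, y, rfl⟩
      have hx := G.ends_mem _ hfG x (by simp [hxy])
      have hy := G.ends_mem _ hfG y (by simp [hxy])
      simp only [h2, huv, hπ.ends, hxy, Sym2.map_mk, Sym2.eq_iff] at h1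
      rcases h1 with ⟨rfl, rfl⟩ | ⟨rfl, rfl⟩
      · exact ⟨x, y, hxy, Finset.mem_filter.2 ⟨hx, rfl⟩, Finset.mem_filter.2 ⟨hy, rfl⟩⟩
      · exact ⟨y, x, hxy.trans Sym2.eq_swap, Finset.mem_filter.2 ⟨hy, rfl⟩,
          Finset.mem_filter.2 ⟨hx, rfl⟩⟩
  · rintro ⟨g, f, hg, hdisj, hcov, hfinj, hfG, hcompl, hfends⟩
    have hsub : ∀ v ∈ H.V, (g v).E ⊆ G.E \ H.E.image f := fun v hv e he => by
      rw [hcompl]; exact Finset.mem_biUnion.2 ⟨v, hv, he⟩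
    have hedge : ∀ e ∈ G.E \ H.E.image f, ∃ v ∈ H.V, ∀ x ∈ G.ends e, x ∈ (g v).V := by
      intro e he
      rw [hcompl] at he
      obtain ⟨v, hv, he⟩ := Finset.mem_biUnion.1 he
      refine ⟨v, hv, fun x hx => (g v).ends_mem e he x ?_⟩
      rwa [(hg v hv).1.2.2 e he]
    have huniq : ∀ u ∈ H.V, ∀ v ∈ H.V, ∀ x, x ∈ (g u).V → x ∈ (g v).V → u = v := by
      intro u hu v hv x hxu hxv
      by_contra h
      exact hdisj u hu v hv h x hxu hxv
    have hρ : ∀ x, ∃ v, x ∈ G.V → v ∈ H.V ∧ x ∈ (g v).V := by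
      intro x
      by_cases hx : x ∈ G.V
      · rw [← hcov] at hx
        obtain ⟨v, hv⟩ := Finset.mem_biUnion.1 hx
        exact ⟨v, fun _ => hv⟩
      · exact ⟨0, fun h => absurd h hx⟩
    choose ρ hρ using hρ
    have hρeq : ∀ v ∈ H.V, ∀ x ∈ (g v).V, ρ x = v := fun v hv x hx =>
      have h := hρ x ((hg v hv).1.1 hx)
      huniq _ h.1 v hv x h.2 hx
    obtain ⟨K, π, hGK, hKV, hKE, hKends, hπ⟩ :=
      MGraph.exists_ccMinorKeep_of_bridgeless _ G (G.E \ H.E.image f) le_rfl Finset.sdiff_subset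
        (by
          intro e he x y hxy
          obtain ⟨v, hv, hev⟩ := hedge e he
          exact (hg v hv).1.reachIn_erase (hg v hv).2 (hsub v hv) e (hev x (by simp [hxy]))
            (hev y (by simp [hxy])))
    have hKE' : K.E = H.E.image f := by
      rw [hKE, Finset.sdiff_sdiff_eq_self]
      intro e he
      obtain ⟨d, hd, rfl⟩ := Finset.mem_image.1 he
      exact hfG d hd
    have hρπ : ∀ x ∈ G.V, ∀ y ∈ G.V, (π x = π y ↔ ρ x = ρ y) := by
      intro x hx y hy
      rw [hπ x hx y hy]
      constructor
      · intro h
        refine h.preserves (p := fun w => ρ x = ρ w) (fun e he a b hab ha => ha.trans ?_) rfl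
        obtain ⟨v, hv, hev⟩ := hedge e he
        rw [hρeq v hv a (hev a (by simp [hab])), hρeq v hv b (hev b (by simp [hab]))]
      · intro h
        have hx' := hρ x hx
        have hy' := (hρ y hy).2
        rw [← h] at hy'
        exact ((hg _ hx'.1).1.reachIn_erase (hg _ hx'.1).2 (hsub _ hx'.1) 0 hx'.2 hy').mono
          (Finset.erase_subset _ _)
    have hσ := Set.surjOn_image π (G.V : Set ℕ) |>.mapsTo_invFunOn
    have hσ' := Set.surjOn_image π (G.V : Set ℕ) |>.rightInvOn_invFunOn
    set σ := Function.invFunOn π (G.V : Set ℕ)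
    have hφ : ∀ x ∈ G.V, ρ (σ (π x)) = ρ x := fun x hx =>
      have hm := Set.mem_image_of_mem π (Finset.mem_coe.2 hx)
      (hρπ _ (hσ hm) x hx).1 (hσ' hm)
    have hinv := hfinj.leftInvOn_invFunOn
    refine ⟨K, hGK, ρ ∘ σ, Function.invFunOn f (H.E : Set ℕ), ⟨?_, ?_, ?_⟩, ⟨?_, ?_, ?_⟩, ?_⟩
    · intro k hk
      rw [hKV] at hk
      obtain ⟨x, hx, rfl⟩ := Finset.mem_image.1 hk
      rw [Function.comp, hφ x hx]
      exact (hρ x hx).1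
    · intro k hk l hl hkl
      rw [hKV] at hk hl
      obtain ⟨x, hx, rfl⟩ := Finset.mem_image.1 hk
      obtain ⟨y, hy, rfl⟩ := Finset.mem_image.1 hl
      rw [Function.comp, Function.comp, hφ x hx, hφ y hy] at hkl
      exact (hρπ x hx y hy).2 hkl
    · intro v hv
      have hne : (g v).V.Nonempty := by
        rw [← Finset.card_pos]
        rcases (hg v hv).2 with h | h
        · have := h.1
          omega
        · omega
      obtain ⟨x, hx⟩ := hne
      have hxG := (hg v hv).1.1 hx
      refine ⟨π x, ?_, (hφ x hxG).trans (hρeq v hv x hx)⟩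
      rw [hKV]
      exact Finset.mem_image_of_mem _ hxG
    · intro k hk
      rw [hKE'] at hk
      obtain ⟨e, he, rfl⟩ := Finset.mem_image.1 hk
      rw [hinv he]
      exact he
    · intro k hk l hl hkl
      rw [hKE'] at hk hl
      obtain ⟨d, hd, rfl⟩ := Finset.mem_image.1 hk
      obtain ⟨e, he, rfl⟩ := Finset.mem_image.1 hl
      rw [hinv hd, hinv he] at hkl
      rw [hkl]
    · intro e he
      refine ⟨f e, ?_, hinv he⟩
      rw [hKE']
      exact Finset.mem_image_of_mem _ he
    · intro k hk
      rw [hKE'] at hk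
      obtain ⟨e, he, rfl⟩ := Finset.mem_image.1 hk
      rw [hinv he, hKends]
      obtain ⟨u, v, huv⟩ : ∃ u v, H.ends e = s(u, v) := by
        induction H.ends e with | _ u v => exact ⟨u, v, rfl⟩
      obtain ⟨a, b, hab, ha, hb⟩ := hfends e he u v huv
      have hu := H.ends_mem e he u (by simp [huv])
      have hv := H.ends_mem e he v (by simp [huv])
      simp only [hab, huv, Sym2.map_mk, Function.comp]
      rw [hφ a ((hg u hu).1.1 ha), hφ b ((hg v hv).1.1 hb), hρeq u hu a ha, hρeq v hv b hb]
end
end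

section
/- Let G be a graph, and let X and Y be two disjoint sets of vertices of G. Let C be a cycle of G such that V(C) ∩ X ≠ ∅ and V(C) ∩ Y = ∅, and let X' = V(G[X ∪ V(C)]/C) be the image of X after contracting C. If there are k pairwise internally disjoint XY-paths in G, then there are at least k pairwise internally disjoint X'Y-paths in G/C. -/
open scoped Classical

noncomputable section

/-- An `XY`-path: a path whose vertex set meets `X` exactly in its first vertex and `Y`
exactly in its last vertex. -/
def IsXYPath (G : MGraph) (X Y : Finset ℕ) (vs es : List ℕ) : Prop :=
  G.IsWalk vs es ∧ vs.Nodup ∧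
  (∃ x, vs.head? = some x ∧ x ∈ X) ∧ (∃ y, vs.getLast? = some y ∧ y ∈ Y) ∧
  (∀ w ∈ vs, w ∈ X → vs.head? = some w) ∧ (∀ w ∈ vs, w ∈ Y → vs.getLast? = some w)

/-- A family of `k` pairwise internally disjoint `XY`-paths: pairwise distinct, and any
common vertex of two of them lies in `X ∪ Y`. -/
def XYFamily (G : MGraph) (X Y : Finset ℕ) (k : ℕ) (P : Fin k → List ℕ × List ℕ) : Prop :=
  (∀ i, IsXYPath G X Y (P i).1 (P i).2) ∧
  (∀ i j, i ≠ j → P i ≠ P j) ∧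
  (∀ i j, i ≠ j → ∀ w, w ∈ (P i).1 → w ∈ (P j).1 → w ∈ X ∨ w ∈ Y)

namespace MGraph

theorem cmapOn_of_notMem (G : MGraph) {U : Finset ℕ} {v : ℕ} (hv : v ∉ U) :
    G.cmapOn U v = v := by
  simp [cmapOn, hv]

theorem cmapOn_mem (G : MGraph) {U : Finset ℕ} (hU : U ⊆ G.V) {v : ℕ} (hv : v ∈ U) :
    G.cmapOn U v ∈ U := by
  have h : v ∈ U ∩ G.V := Finset.mem_inter.mpr ⟨hv, hU hv⟩
  have hmem : sInf {x : ℕ | x ∈ U ∩ G.V} ∈ U ∩ G.V := Nat.sInf_mem ⟨v, h⟩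
  rw [cmapOn, if_pos h]
  exact (Finset.mem_inter.mp hmem).1

/-- A walk with a vertex in `Z` has a terminal segment meeting `Z` exactly in its first vertex. -/
theorem IsWalk.exists_suffix {G : MGraph} {vs es : List ℕ} (hw : G.IsWalk vs es)
    (Z : Finset ℕ) (hZ : ∃ w ∈ vs, w ∈ Z) :
    ∃ a t es', G.IsWalk (a :: t) es' ∧ a ∈ Z ∧ (∀ w ∈ t, w ∉ Z) ∧ (a :: t) <:+ vs ∧
      (vs.Nodup → vs.head? = some a → vs = a :: t ∧ es = es') := by
  induction hw with
  | @nil v hv =>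
    refine ⟨v, [], [], .nil hv, by simpa using hZ, by simp, List.suffix_rfl, by simp⟩
  | @cons u v e vs es he hends hw ih =>
    by_cases h : ∃ w ∈ v :: vs, w ∈ Z
    · obtain ⟨a, t, es', hwalk, ha, ht, hsuf, -⟩ := ih h
      refine ⟨a, t, es', hwalk, ha, ht, hsuf.trans (List.suffix_cons _ _), ?_⟩
      intro hnd hhead
      obtain rfl : u = a := by simpa using hhead
      exact absurd (hsuf.subset List.mem_cons_self) (List.nodup_cons.mp hnd).1
    · push Not at h
      obtain ⟨w, hwm, hwZ⟩ := hZ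
      refine ⟨u, v :: vs, e :: es, .cons he hends hw, ?_, h, List.suffix_rfl, by simp⟩
      rcases List.mem_cons.mp hwm with rfl | hwm
      · exact hwZ
      · exact absurd hwZ (h w hwm)

/-- A walk avoiding `U` except possibly at its first vertex survives contraction of `U`. -/
theorem IsWalk.contractOn {G : MGraph} {vs es : List ℕ} (hw : G.IsWalk vs es)
    (U S : Finset ℕ) (hU : ∀ w ∈ vs.tail, w ∉ U) :
    (G.contractOn U S).IsWalk (vs.map (G.cmapOn U)) es := by
  induction hw with
  | nil hv => exact .nil (Finset.mem_image_of_mem _ hv)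
  | @cons u v e vs es he hends hw ih =>
    refine .cons (Finset.mem_filter.mpr ⟨he, Or.inl fun h => ?_⟩) ?_
      (ih fun w hwm => hU w (List.mem_cons_of_mem _ hwm))
    · exact hU v (by simp) (h v (by simp [hends]))
    · simp [MGraph.contractOn, hends]

/-- Two walks with the same edges whose vertices agree after the first one are equal, provided
they have at least one edge. -/
theorem IsWalk.head_eq {G : MGraph} {a b : ℕ} {t es : List ℕ} (ht : t ≠ [])
    (ha : G.IsWalk (a :: t) es) (hb : G.IsWalk (b :: t) es) : a = b := by
  cases ha with
  | nil => exact absurd rfl ht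
  | cons _ h _ =>
    cases hb with
    | cons _ h' _ => exact Sym2.congr_left.mp (h.symm.trans h')

end MGraph

/-- If `X` and `Y` are disjoint vertex sets of `G`, and `C` is a cycle meeting `X` but not
`Y`, and `G` has `k` internally disjoint `XY`-paths, then `G/C` has at least `k` internally
disjoint `X'Y`-paths, where `X'` is the image of `X ∪ V(C)` under the contraction. -/
theorem statement_3 (G : MGraph) (X Y : Finset ℕ) (k : ℕ)
    (hX : X ⊆ G.V) (hY : Y ⊆ G.V) (hdisj : ∀ x ∈ X, x ∉ Y)
    (C : Finset ℕ) (hC : G.IsCycleSet C)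
    (hCX : (G.vertsOf C ∩ X).Nonempty) (hCY : G.vertsOf C ∩ Y = ∅)
    (hpaths : ∃ P : Fin k → List ℕ × List ℕ, XYFamily G X Y k P) :
    ∃ P' : Fin k → List ℕ × List ℕ,
      XYFamily (G.contractCycle C)
        ((X ∪ G.vertsOf C).image (G.cmapOn (G.vertsOf C))) Y k P' := by
  obtain ⟨P, hP, hne, hint⟩ := hpaths
  set U := G.vertsOf C
  have hUV : U ⊆ G.V := Finset.filter_subset _ _
  have hUY : ∀ w ∈ U, w ∉ Y := fun w hw hwY => by
    have : w ∈ U ∩ Y := Finset.mem_inter.mpr ⟨hw, hwY⟩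
    simp [hCY] at this
  have hZY : ∀ w ∈ X ∪ U, w ∉ Y := fun w hw =>
    (Finset.mem_union.mp hw).elim (hdisj w) (hUY w)
  have key : ∀ i, ∃ a t es', G.IsWalk (a :: t) es' ∧ a ∈ X ∪ U ∧ (∀ w ∈ t, w ∉ X ∪ U) ∧
      (a :: t) <:+ (P i).1 ∧
      ((P i).1.Nodup → (P i).1.head? = some a → (P i).1 = a :: t ∧ (P i).2 = es') := by
    intro i
    obtain ⟨hw, -, ⟨x, hx, hxX⟩, -⟩ := hP i
    exact hw.exists_suffix (X ∪ U) ⟨x, List.mem_of_head? hx, Finset.mem_union_left _ hxX⟩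
  choose a t es hwalk ha ht hsuf hfull using key
  have hf : ∀ i, ∀ w ∈ t i, G.cmapOn U w = w := fun i w hw =>
    G.cmapOn_of_notMem fun h => ht i w hw (Finset.mem_union_right _ h)
  have hmap : ∀ i, (t i).map (G.cmapOn U) = t i := fun i =>
    (List.map_congr_left (hf i)).trans (List.map_id _)
  have hlast : ∀ i, (a i :: t i).getLast? = (P i).1.getLast? := by
    intro i
    obtain ⟨l, hl⟩ := hsuf i
    rw [← hl, List.getLast?_append_of_ne_nil _ (by simp)]
  have hfa : ∀ i, G.cmapOn U (a i) ∈ X ∪ U := by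
    intro i
    by_cases h : a i ∈ U
    · exact Finset.mem_union_right _ (G.cmapOn_mem hUV h)
    · rw [G.cmapOn_of_notMem h]
      exact ha i
  have htne : ∀ i, t i ≠ [] := by
    intro i h
    obtain ⟨-, -, -, ⟨y, hy, hyY⟩, -⟩ := hP i
    rw [← hlast i, h] at hy
    obtain rfl : a i = y := by simpa using hy
    exact hZY _ (ha i) hyY
  refine ⟨fun i => (G.cmapOn U (a i) :: t i, es i), ?_, ?_, ?_⟩
  · intro i
    obtain ⟨-, hnd, -, ⟨y, hy, hyY⟩, -, hYlast⟩ := hP i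
    have hlast' : (G.cmapOn U (a i) :: t i).getLast? = (P i).1.getLast? := by
      rw [← hlast i, List.getLast?_cons_of_ne_nil (htne i), List.getLast?_cons_of_ne_nil (htne i)]
    refine ⟨?_, ?_, ⟨_, rfl, Finset.mem_image_of_mem _ (ha i)⟩, ⟨y, hlast'.trans hy, hyY⟩, ?_, ?_⟩
    · have := (hwalk i).contractOn U C
        fun w hw h => ht i w hw (Finset.mem_union_right _ h)
      rwa [List.map_cons, hmap] at this
    · exact List.nodup_cons.mpr ⟨fun h => ht i _ h (hfa i),
        (List.nodup_cons.mp (hnd.sublist (hsuf i).sublist)).2⟩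
    · intro w hw hwX
      rcases List.mem_cons.mp hw with rfl | hw
      · rfl
      · obtain ⟨z, hz, rfl⟩ := Finset.mem_image.mp hwX
        refine absurd ?_ (ht i _ hw)
        by_cases h : z ∈ U
        · exact Finset.mem_union_right _ (G.cmapOn_mem hUV h)
        · rwa [G.cmapOn_of_notMem h]
    · intro w hw hwY
      rcases List.mem_cons.mp hw with rfl | hw
      · exact absurd hwY (hZY _ (hfa i))
      · exact hlast'.trans
          (hYlast w ((hsuf i).subset (List.mem_cons_of_mem _ hw)) hwY)
  · intro i j hij heq
    obtain ⟨hv, hes⟩ := Prod.mk.inj heq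
    obtain ⟨-, htt⟩ := List.cons.inj hv
    have haa : a i = a j := (hwalk i).head_eq (htne i) (by rw [htt, hes]; exact hwalk j)
    have hai : a i ∈ (P i).1 := (hsuf i).subset List.mem_cons_self
    have haj : a j ∈ (P j).1 := (hsuf j).subset List.mem_cons_self
    have hX' : a i ∈ X :=
      (hint i j hij _ hai (haa ▸ haj)).resolve_right (hZY _ (ha i))
    obtain ⟨-, hndi, -, -, hXi, -⟩ := hP i
    obtain ⟨-, hndj, -, -, hXj, -⟩ := hP j
    obtain ⟨hi1, hi2⟩ := hfull i hndi (hXi _ hai hX')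
    obtain ⟨hj1, hj2⟩ := hfull j hndj (hXj _ haj (haa ▸ hX'))
    exact hne i j hij (Prod.ext (by rw [hi1, hj1, haa, htt]) (by rw [hi2, hj2, hes]))
  · intro i j hij w hwi hwj
    rcases List.mem_cons.mp hwi with rfl | hwi
    · exact Or.inl (Finset.mem_image_of_mem _ (ha i))
    rcases List.mem_cons.mp hwj with rfl | hwj
    · exact Or.inl (Finset.mem_image_of_mem _ (ha j))
    refine Or.inr ((hint i j hij w ((hsuf i).subset (List.mem_cons_of_mem _ hwi))
      ((hsuf j).subset (List.mem_cons_of_mem _ hwj))).resolve_left fun h => ?_)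
    exact ht i w hwi (Finset.mem_union_left _ h)
end
end

section
/- For a positive integer k, let G be a k-edge-connected graph, and let H be a cc-minor of G with at least two vertices. Then H is k-edge-connected. -/
open scoped Classical

noncomputable section

namespace MGraph

theorem cmapOn_of_mem {G : MGraph} {U : Finset ℕ} {v : ℕ} (hU : v ∈ U) (hV : v ∈ G.V) :
    G.cmapOn U v = sInf {w : ℕ | w ∈ U ∩ G.V} :=
  if_pos (Finset.mem_inter.mpr ⟨hU, hV⟩)

/-- An edge of `G` outside `Z` either survives in the contraction or has its ends identified. -/
theorem Adj.reach_contractOn {G : MGraph} {U S Z : Finset ℕ} {a b : ℕ}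
    (h : (G.deleteEdges Z).Adj a b) :
    ((G.contractOn U S).deleteEdges Z).Reach (G.cmapOn U a) (G.cmapOn U b) := by
  obtain ⟨e, he, hab⟩ := h
  change G.ends e = s(a, b) at hab
  obtain ⟨heE, heZ⟩ := Finset.mem_sdiff.mp he
  by_cases hU : ∀ v ∈ G.ends e, v ∈ U
  · have ha : a ∈ G.ends e := hab ▸ Sym2.mem_mk_left a b
    have hb : b ∈ G.ends e := hab ▸ Sym2.mem_mk_right a b
    rw [cmapOn_of_mem (hU a ha) (G.ends_mem e heE a ha),
      cmapOn_of_mem (hU b hb) (G.ends_mem e heE b hb)]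
    exact Relation.ReflTransGen.refl
  · refine Relation.ReflTransGen.single ⟨e, ?_, ?_⟩
    · exact Finset.mem_sdiff.mpr ⟨Finset.mem_filter.mpr ⟨heE, Or.inl hU⟩, heZ⟩
    · change (G.ends e).map (G.cmapOn U) = _
      rw [hab, Sym2.map_mk]

theorem Reach.contractOn {G : MGraph} {U S Z : Finset ℕ} {a b : ℕ}
    (h : (G.deleteEdges Z).Reach a b) :
    ((G.contractOn U S).deleteEdges Z).Reach (G.cmapOn U a) (G.cmapOn U b) := by
  induction h with
  | refl => exact Relation.ReflTransGen.refl
  | tail _ hbc ih => exact Relation.ReflTransGen.trans ih (Adj.reach_contractOn hbc)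

theorem Connected.contractOn {G : MGraph} {U S Z : Finset ℕ}
    (h : (G.deleteEdges Z).Connected) : ((G.contractOn U S).deleteEdges Z).Connected := by
  refine ⟨Finset.Nonempty.image h.1 _, fun u hu v hv => ?_⟩
  obtain ⟨a, ha, rfl⟩ := Finset.mem_image.mp hu
  obtain ⟨b, hb, rfl⟩ := Finset.mem_image.mp hv
  exact Reach.contractOn (h.2 a ha b hb)

theorem EdgeConnected.contractOn {G : MGraph} {k : ℕ} (h : G.EdgeConnected k) (U S : Finset ℕ)
    (hV : 2 ≤ (G.contractOn U S).V.card) : (G.contractOn U S).EdgeConnected k :=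
  ⟨hV, fun Z hZ hk => Connected.contractOn (h.2 Z (hZ.trans (Finset.filter_subset _ _)) hk)⟩

end MGraph

/-- For a positive integer `k`, if `G` is a `k`-edge-connected graph and `H` is a
cc-minor of `G` with at least two vertices, then `H` is `k`-edge-connected. -/
theorem statement_4 (k : ℕ) (hk : 0 < k) (G H : MGraph)
    (hG : G.EdgeConnected k) (hH : G.CCMinor H) (hV : 2 ≤ H.V.card) :
    H.EdgeConnected k := by
  induction hH with
  | refl => exact hG
  | tail _ hstep ih =>
    obtain ⟨C, -, rfl⟩ := hstep
    exact (ih (hV.trans Finset.card_image_le)).contractOn _ _ hV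
end
end
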